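/- Let N = 1 or N = 2 and let 2 ≤ q < ∞, and set θ := (N/2)(1 − 2/q). There exists a constant K_{N,θ} > 0 such that for every open connected set Ω ⊊ ℝ^N and every u ∈ C_0^∞(Ω) one has ( ∫_Ω (|∇u|² − |u|²/(4 D_Ω(x)²)) dx )^θ ( ∫_Ω |u|² dx )^{1−θ} ≥ K_{N,θ} ( ∫_Ω |u|^q dx )^{2/q}. -/

import Mathlib

open MeasureTheory Metric Set

noncomputable def dirDist {N : ℕ} (Ω : Set (EuclideanSpace ℝ (Fin N)))
    (x e : EuclideanSpace ℝ (Fin N)) : ℝ :=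
  sInf {r : ℝ | ∃ t : ℝ, r = |t| ∧ x + t • e ∈ Ωᶜ}

noncomputable def daviesWeight {N : ℕ} (Ω : Set (EuclideanSpace ℝ (Fin N)))
    (x : EuclideanSpace ℝ (Fin N)) : ℝ :=
  ((N : ℝ) * ⨍ e : sphere (0 : EuclideanSpace ℝ (Fin N)) 1,
      (dirDist Ω x (e : EuclideanSpace ℝ (Fin N)) ^ 2)⁻¹ ∂volume.toSphere) ^ (-(1:ℝ)/2)



/-- Cauchy–Schwarz in square-root form. -/
lemma integral_sqrt_mul_sqrt_le {α : Type*} [MeasurableSpace α] {μ : Measure α} {f g : α → ℝ}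
    (hf0 : ∀ x, 0 ≤ f x) (hg0 : ∀ x, 0 ≤ g x) (hf : Integrable f μ) (hg : Integrable g μ) :
    ∫ x, √(f x) * √(g x) ∂μ ≤ √(∫ x, f x ∂μ) * √(∫ x, g x ∂μ) := by
  have key : ∀ h : α → ℝ, (∀ x, 0 ≤ h x) → Integrable h μ →
      MemLp (fun x => √(h x)) (ENNReal.ofReal 2) μ := by
    intro h h0 hi
    have : AEStronglyMeasurable (fun x => √(h x)) μ :=
      Real.continuous_sqrt.comp_aestronglyMeasurable hi.1
    rw [ENNReal.ofReal_ofNat, memLp_two_iff_integrable_sq this]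
    simpa [Real.sq_sqrt, h0] using hi
  have := integral_mul_le_Lp_mul_Lq_of_nonneg (μ := μ) Real.HolderConjugate.two_two
    (ae_of_all _ fun x => Real.sqrt_nonneg (f x)) (ae_of_all _ fun x => Real.sqrt_nonneg (g x))
    (key f hf0 hf) (key g hg0 hg)
  rw [← Real.sqrt_eq_rpow, ← Real.sqrt_eq_rpow] at this
  simpa [Real.sq_sqrt, hf0, hg0] using this

lemma integrable_sqrt_mul_sqrt {α : Type*} [MeasurableSpace α] {μ : Measure α} {f g : α → ℝ}
    (hf0 : ∀ x, 0 ≤ f x) (hg0 : ∀ x, 0 ≤ g x) (hf : Integrable f μ) (hg : Integrable g μ) :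
    Integrable (fun x => √(f x) * √(g x)) μ := by
  refine (hf.add hg).mono' ((Real.continuous_sqrt.comp_aestronglyMeasurable hf.1).mul
    (Real.continuous_sqrt.comp_aestronglyMeasurable hg.1)) (ae_of_all _ fun x => ?_)
  rw [Real.norm_of_nonneg (by positivity)]
  simp only [Pi.add_apply]
  nlinarith [Real.sq_sqrt (hf0 x), Real.sq_sqrt (hg0 x), sq_nonneg (√(f x) - √(g x)),
    hf0 x, hg0 x]

/-- Ground state substitution for the one-dimensional Hardy inequality. -/
lemma hasDerivAt_div_sqrt {u : ℝ → ℝ} (hu : Differentiable ℝ u) {t : ℝ} (ht : 0 < t) :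
    HasDerivAt (fun s => u s / √s) ((deriv u t - u t / (2 * t)) / √t) t := by
  have h := (hu t).hasDerivAt.div (Real.hasDerivAt_sqrt ht.ne') (Real.sqrt_pos.2 ht).ne'
  refine h.congr_deriv ?_
  have hs := Real.sq_sqrt ht.le
  have h0 := Real.sqrt_pos.2 ht
  rw [hs]
  generalize √t = s at *
  subst hs
  field_simp

lemma continuous_div_of_zero_notMem_tsupport {u : ℝ → ℝ} (hu : Continuous u)
    (h0 : (0 : ℝ) ∉ tsupport u) : Continuous fun t => u t / t := by
  rw [continuous_iff_continuousAt]
  intro t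
  by_cases ht : t = 0
  · subst ht
    have : (fun t => u t / t) =ᶠ[nhds 0] fun _ => 0 := by
      filter_upwards [notMem_tsupport_iff_eventuallyEq.1 h0] with s hs
      simp [hs]
    exact (continuousAt_const).congr this.symm
  · exact hu.continuousAt.div continuousAt_id ht

lemma hardy_identity {u : ℝ → ℝ} (hu : ContDiff ℝ 1 u) (h0 : (0 : ℝ) ∉ tsupport u)
    (m : ℝ) :
    ∫ t in (0:ℝ)..m, (deriv u t ^ 2 - u t ^ 2 / 4 * (t ^ 2)⁻¹) =
      (∫ t in (0:ℝ)..m, (deriv u t - u t / (2 * t)) ^ 2) + u m ^ 2 / (2 * m) := by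
  have hc := continuous_div_of_zero_notMem_tsupport hu.continuous h0
  have hd : Continuous (deriv u) := hu.continuous_deriv le_rfl
  have hder : ∀ t : ℝ, HasDerivAt (fun s => u s * u s / (2 * s))
      (deriv u t * (u t / t) - (u t / t) ^ 2 / 2) t := by
    intro t
    by_cases ht : t = 0
    · subst ht
      have h1 : (fun s => u s * u s / (2 * s)) =ᶠ[nhds 0] fun _ => 0 := by
        filter_upwards [notMem_tsupport_iff_eventuallyEq.1 h0] with s hs
        simp [hs]
      have := (hasDerivAt_const (0:ℝ) (0:ℝ)).congr_of_eventuallyEq h1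
      simpa using this
    · have hu' := (hu.differentiable one_ne_zero t).hasDerivAt
      have h := (hu'.mul hu').div ((hasDerivAt_id t).const_mul 2) (by simpa using ht)
      refine h.congr_deriv ?_
      simp only [id, Pi.mul_apply]
      field_simp
      ring
  have hcd : Continuous fun t => deriv u t * (u t / t) - (u t / t) ^ 2 / 2 := by fun_prop
  have hF := intervalIntegral.integral_eq_sub_of_hasDerivAt (fun t _ => hder t)
    (hcd.intervalIntegrable 0 m)
  have hz : Continuous fun t => (deriv u t - u t / (2 * t)) ^ 2 := by
    have : (fun t => (deriv u t - u t / (2 * t)) ^ 2) =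
        fun t => (deriv u t - (u t / t) / 2) ^ 2 := by
      funext t; rw [div_div, mul_comm t 2]
    rw [this]; fun_prop
  have : (u m ^ 2 / (2 * m)) = ∫ t in (0:ℝ)..m, (deriv u t * (u t / t) - (u t / t) ^ 2 / 2) := by
    rw [hF]; simp [sq]
  rw [this, ← intervalIntegral.integral_add (hz.intervalIntegrable _ _)
    (hcd.intervalIntegrable _ _)]
  congr 1
  funext t
  rw [mul_comm 2 t, ← div_div, ← inv_pow, div_eq_mul_inv (u t) t]
  ring

/-- Sup-norm bound by the Hardy energy on an interval with one singular endpoint. -/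
lemma half_interval_estimate (p : ℕ) {u : ℝ → ℝ} (hu : ContDiff ℝ 1 u)
    (h0 : (0 : ℝ) ∉ tsupport u) {m : ℝ} (hm : 0 < m) :
    0 ≤ ∫ t in (0:ℝ)..m, (deriv u t ^ 2 - u t ^ 2 / 4 * (t ^ 2)⁻¹) ∧
    ∀ x, 0 < x → x ≤ m → |u x| ^ (p + 1) ≤ (2 ^ (p + 1) * (p + 2) + (p + 1)) *
      (√(∫ t in (0:ℝ)..m, (deriv u t ^ 2 - u t ^ 2 / 4 * (t ^ 2)⁻¹)) *
        √(∫ t in (0:ℝ)..m, u t ^ (2 * p))) := by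
  rw [hardy_identity hu h0 m]
  set Z := ∫ t in (0:ℝ)..m, (deriv u t - u t / (2 * t)) ^ 2 with hZ
  set U := ∫ t in (0:ℝ)..m, u t ^ (2 * p) with hU
  set E := Z + u m ^ 2 / (2 * m) with hE
  have hcont := hu.continuous
  have hZ0 : 0 ≤ Z := intervalIntegral.integral_nonneg hm.le fun t _ => by positivity
  have hB0 : 0 ≤ u m ^ 2 / (2 * m) := by positivity
  have hE0 : 0 ≤ E := by positivity
  refine ⟨hE0, ?_⟩
  have hpow : ∀ t, 0 ≤ u t ^ (2 * p) := fun t => by rw [pow_mul]; positivity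
  have hU0 : 0 ≤ U := intervalIntegral.integral_nonneg hm.le fun t _ => hpow t
  set z : ℝ → ℝ := fun t => deriv u t - u t / (2 * t) with hz
  have hd : Continuous (deriv u) := hu.continuous_deriv le_rfl
  have hzc : Continuous z := by
    have hc := continuous_div_of_zero_notMem_tsupport hu.continuous h0
    have : z = fun t => deriv u t - (u t / t) / 2 := by
      funext t; simp only [hz]; rw [div_div, mul_comm t 2]
    rw [this]; fun_prop
  set v : ℝ → ℝ := fun t => u t / √t with hv
  have hvu : ∀ t, 0 < t → u t = √t * v t := fun t ht => by
    have := Real.sqrt_pos.2 ht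
    simp only [hv]; field_simp
  have hvder : ∀ t, 0 < t → HasDerivAt v (z t / √t) t := fun t ht =>
    hasDerivAt_div_sqrt (hu.differentiable one_ne_zero) ht
  clear_value z v
  set Y := √E * √U with hY
  have hY0 : 0 ≤ Y := by positivity
  -- the basic transport estimate
  have hCS : ∀ x y, 0 < x → x ≤ y → y ≤ m → ∫ t in x..y, |u t| ^ p * |z t| ≤ Y := by
    intro x y hx hxy hym
    have h1 : ∫ t in x..y, |u t| ^ p * |z t| ≤ ∫ t in (0:ℝ)..m, |u t| ^ p * |z t| := by
      refine intervalIntegral.integral_mono_interval hx.le hxy hym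
        (ae_of_all _ fun t => by positivity) (Continuous.intervalIntegrable (by fun_prop) _ _)
    refine h1.trans ?_
    have h2 := integral_sqrt_mul_sqrt_le (μ := volume.restrict (Ioc 0 m))
      (f := fun t => z t ^ 2) (g := fun t => u t ^ (2 * p))
      (fun t => by positivity) hpow
      ((intervalIntegrable_iff_integrableOn_Ioc_of_le hm.le).1
        (Continuous.intervalIntegrable (by fun_prop) _ _))
      ((intervalIntegrable_iff_integrableOn_Ioc_of_le hm.le).1
        (Continuous.intervalIntegrable (by fun_prop) _ _))
    rw [← intervalIntegral.integral_of_le hm.le, ← intervalIntegral.integral_of_le hm.le,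
      ← intervalIntegral.integral_of_le hm.le] at h2
    have h3 : ∀ t, √(z t ^ 2) * √(u t ^ (2 * p)) = |u t| ^ p * |z t| := fun t => by
      rw [Real.sqrt_sq_eq_abs, mul_comm 2 p, pow_mul, Real.sqrt_sq_eq_abs, abs_pow, mul_comm]
    simp only [h3] at h2
    refine h2.trans ?_
    rw [hY]
    have h4 : ∫ t in (0:ℝ)..m, z t ^ 2 ≤ E := by
      rw [hE, hZ, hz]
      exact le_add_of_nonneg_right hB0
    gcongr
  have htrans : ∀ x y, 0 < x → x ≤ y → y ≤ m →
      √x ^ (p + 1) * |v x ^ (p + 1) - v y ^ (p + 1)| ≤ (p + 1) * Y := by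
    intro x y hx hxy hym
    have hpos : ∀ t ∈ uIcc x y, 0 < t := fun t ht => by
      rw [uIcc_of_le hxy] at ht; exact hx.trans_le ht.1
    have hder : ∀ t ∈ uIcc x y, HasDerivAt (fun s => v s ^ (p + 1))
        ((p + 1) * v t ^ p * (z t / √t)) t := fun t ht => by
      simpa using (hvder t (hpos t ht)).fun_pow (p + 1)
    have hvc : ContinuousOn v (uIcc x y) := fun t ht =>
      (hvder t (hpos t ht)).continuousAt.continuousWithinAt
    have hzs : ContinuousOn (fun t => z t / √t) (uIcc x y) := by
      refine hzc.continuousOn.div Real.continuous_sqrt.continuousOn fun t ht =>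
        (Real.sqrt_pos.2 (hpos t ht)).ne'
    have hic : ContinuousOn (fun t => (p + 1) * v t ^ p * (z t / √t)) (uIcc x y) := by
      fun_prop
    have hF := intervalIntegral.integral_eq_sub_of_hasDerivAt hder hic.intervalIntegrable
    rw [abs_sub_comm, ← hF]
    calc √x ^ (p + 1) * |∫ t in x..y, (p + 1) * v t ^ p * (z t / √t)|
        ≤ √x ^ (p + 1) * ∫ t in x..y, |(p + 1) * v t ^ p * (z t / √t)| := by
          gcongr
          exact intervalIntegral.abs_integral_le_integral_abs hxy
      _ = ∫ t in x..y, √x ^ (p + 1) * |(p + 1) * v t ^ p * (z t / √t)| := by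
          rw [intervalIntegral.integral_const_mul]
      _ ≤ ∫ t in x..y, (p + 1) * (|u t| ^ p * |z t|) := by
          refine intervalIntegral.integral_mono_on hxy ?_
            (Continuous.intervalIntegrable (by fun_prop) _ _) fun t ht => ?_
          · exact (continuousOn_const.mul hic.abs).intervalIntegrable
          · have ht0 : 0 < t := hx.trans_le ht.1
            have hs := Real.sqrt_pos.2 ht0
            have hxt : √x ≤ √t := Real.sqrt_le_sqrt ht.1
            rw [hvu t ht0, abs_mul, abs_mul, abs_pow, abs_div, abs_mul, abs_of_pos hs,
              abs_of_nonneg (by positivity : (0:ℝ) ≤ p + 1)]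
            calc √x ^ (p + 1) * ((p + 1) * |v t| ^ p * (|z t| / √t))
                ≤ √t ^ (p + 1) * ((p + 1) * |v t| ^ p * (|z t| / √t)) := by gcongr
              _ = _ := by rw [mul_pow]; field_simp; ring
      _ = (p + 1) * ∫ t in x..y, |u t| ^ p * |z t| := intervalIntegral.integral_const_mul _ _
      _ ≤ _ := by gcongr; exact hCS x y hx hxy hym
  -- the midpoint value
  have hmid : |u m| ^ (p + 1) ≤ 2 ^ (p + 1) * (p + 2) * Y := by
    obtain ⟨t₀, ht₀, hmin⟩ := (isCompact_Icc (a := m / 2) (b := m)).exists_isMinOn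
      ⟨m, by constructor <;> linarith⟩ (f := fun t => u t ^ (2 * p))
      (by fun_prop)
    have ht0 : 0 < t₀ := by linarith [ht₀.1]
    have hle : m / 2 * u t₀ ^ (2 * p) ≤ U := by
      calc m / 2 * u t₀ ^ (2 * p) = ∫ _ in (m / 2)..m, u t₀ ^ (2 * p) := by
            rw [intervalIntegral.integral_const, smul_eq_mul]; ring
        _ ≤ ∫ t in (m / 2)..m, u t ^ (2 * p) := by
            refine intervalIntegral.integral_mono_on (by linarith) (by simp)
              (Continuous.intervalIntegrable (by fun_prop) _ _) fun t ht => hmin ht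
        _ ≤ U := by
            refine intervalIntegral.integral_mono_interval (by linarith) (by linarith) le_rfl
              (ae_of_all _ hpow) (Continuous.intervalIntegrable (by fun_prop) _ _)
    have hprod : |u t₀| ^ p * |u m| ≤ 2 * Y := by
      have h1 : u m ^ 2 / (2 * m) ≤ E := le_add_of_nonneg_left hZ0
      rw [div_le_iff₀ (by positivity)] at h1
      have h2 : (|u t₀| ^ p * |u m|) ^ 2 ≤ (2 * Y) ^ 2 := by
        rw [mul_pow, hY, mul_pow, mul_pow, Real.sq_sqrt hE0, Real.sq_sqrt hU0, sq_abs,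
          ← pow_mul, mul_comm p 2, pow_mul, sq_abs, ← pow_mul]
        calc u t₀ ^ (2 * p) * u m ^ 2 ≤ u t₀ ^ (2 * p) * (E * (2 * m)) :=
              mul_le_mul_of_nonneg_left h1 (hpow t₀)
          _ = 4 * E * (m / 2 * u t₀ ^ (2 * p)) := by ring
          _ ≤ 4 * E * U := by gcongr
          _ = _ := by ring
      exact le_of_sq_le_sq h2 (by positivity)
    have hsm := Real.sqrt_pos.2 hm
    have hst := Real.sqrt_pos.2 ht0
    have hmt : √m ≤ 2 * √t₀ := by
      have : √m ≤ √(2 ^ 2 * t₀) := Real.sqrt_le_sqrt (by linarith [ht₀.1])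
      rwa [Real.sqrt_mul (by positivity), Real.sqrt_sq (by norm_num)] at this
    have htr := htrans t₀ m ht0 ht₀.2 le_rfl
    have hvm : |v m| ^ (p + 1) ≤ |v t₀| ^ p * |v m| + |v t₀ ^ (p + 1) - v m ^ (p + 1)| := by
      rcases le_total |v m| |v t₀| with h | h
      · have : |v m| ^ (p + 1) ≤ |v t₀| ^ p * |v m| := by rw [pow_succ]; gcongr
        linarith [abs_nonneg (v t₀ ^ (p + 1) - v m ^ (p + 1))]
      · have h1 : |v t₀| ^ (p + 1) ≤ |v t₀| ^ p * |v m| := by rw [pow_succ]; gcongr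
        have h2 := abs_sub_abs_le_abs_sub (v m ^ (p + 1)) (v t₀ ^ (p + 1))
        rw [abs_sub_comm, abs_pow, abs_pow] at h2
        linarith
    calc |u m| ^ (p + 1) = √m ^ (p + 1) * |v m| ^ (p + 1) := by
          rw [hvu m hm, abs_mul, abs_of_pos hsm, mul_pow]
      _ ≤ √m ^ (p + 1) * (|v t₀| ^ p * |v m| + |v t₀ ^ (p + 1) - v m ^ (p + 1)|) := by gcongr
      _ = √m ^ p * |v t₀| ^ p * (√m * |v m|) +
          √m ^ (p + 1) * |v t₀ ^ (p + 1) - v m ^ (p + 1)| := by ring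
      _ ≤ (2 * √t₀) ^ p * |v t₀| ^ p * (√m * |v m|) +
          (2 * √t₀) ^ (p + 1) * |v t₀ ^ (p + 1) - v m ^ (p + 1)| := by gcongr
      _ = 2 ^ p * (|u t₀| ^ p * |u m|) +
          2 ^ (p + 1) * (√t₀ ^ (p + 1) * |v t₀ ^ (p + 1) - v m ^ (p + 1)|) := by
          rw [hvu m hm, hvu t₀ ht0, abs_mul, abs_mul, abs_of_pos hsm, abs_of_pos hst]; ring
      _ ≤ 2 ^ p * (2 * Y) + 2 ^ (p + 1) * ((p + 1) * Y) := by gcongr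
      _ = _ := by ring
  intro x hx hxm
  have htr := htrans x m hx hxm le_rfl
  have hsx := Real.sqrt_pos.2 hx
  have hsm := Real.sqrt_pos.2 hm
  have hvx : |v x| ^ (p + 1) ≤ |v m| ^ (p + 1) + |v x ^ (p + 1) - v m ^ (p + 1)| := by
    have h2 := abs_sub_abs_le_abs_sub (v x ^ (p + 1)) (v m ^ (p + 1))
    rw [abs_pow, abs_pow] at h2
    linarith
  calc |u x| ^ (p + 1) = √x ^ (p + 1) * |v x| ^ (p + 1) := by
        rw [hvu x hx, abs_mul, abs_of_pos hsx, mul_pow]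
    _ ≤ √x ^ (p + 1) * (|v m| ^ (p + 1) + |v x ^ (p + 1) - v m ^ (p + 1)|) := by gcongr
    _ = √x ^ (p + 1) * |v m| ^ (p + 1) + √x ^ (p + 1) * |v x ^ (p + 1) - v m ^ (p + 1)| := by
        ring
    _ ≤ √m ^ (p + 1) * |v m| ^ (p + 1) + (p + 1) * Y := by gcongr
    _ = |u m| ^ (p + 1) + (p + 1) * Y := by
        rw [hvu m hm, abs_mul, abs_of_pos hsm, mul_pow]
    _ ≤ _ := by linarith

lemma half_interval_left (p : ℕ) {u w : ℝ → ℝ} (hu : ContDiff ℝ 1 u) {a m : ℝ} (ham : a < m)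
    (h0 : a ∉ tsupport u) (hw : ∀ t, a < t → t ≤ m → w t ≤ ((t - a) ^ 2)⁻¹)
    (hi : Integrable fun t => deriv u t ^ 2 - u t ^ 2 / 4 * w t) :
    0 ≤ ∫ t in a..m, (deriv u t ^ 2 - u t ^ 2 / 4 * w t) ∧
    ∀ x, a < x → x ≤ m → |u x| ^ (p + 1) ≤ (2 ^ (p + 1) * (p + 2) + (p + 1)) *
      (√(∫ t in a..m, (deriv u t ^ 2 - u t ^ 2 / 4 * w t)) * √(∫ t in a..m, u t ^ (2 * p))) := by
  have hU : ContDiff ℝ 1 fun t => u (a + t) := hu.comp (contDiff_const.add contDiff_id)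
  have hU0 : (0 : ℝ) ∉ tsupport fun t => u (a + t) := by
    rw [notMem_tsupport_iff_eventuallyEq] at h0 ⊢
    have : Filter.Tendsto (fun t => a + t) (nhds 0) (nhds a) :=
      Continuous.tendsto' (by fun_prop) _ _ (by simp)
    exact this.eventually h0
  obtain ⟨h1, h2⟩ := half_interval_estimate p hU hU0 (sub_pos.2 ham)
  simp only [deriv_comp_const_add] at h1 h2
  have hc := (continuous_div_of_zero_notMem_tsupport hU.continuous hU0)
  have hd : Continuous (deriv u) := hu.continuous_deriv le_rfl
  have hfint : IntervalIntegrable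
      (fun t => deriv u (a + t) ^ 2 - u (a + t) ^ 2 / 4 * (t ^ 2)⁻¹) volume 0 (m - a) := by
    have : (fun t => deriv u (a + t) ^ 2 - u (a + t) ^ 2 / 4 * (t ^ 2)⁻¹) =
        fun t => deriv u (a + t) ^ 2 - (u (a + t) / t) ^ 2 / 4 := by
      funext t; rw [div_pow]; ring
    rw [this]
    exact Continuous.intervalIntegrable (by fun_prop) _ _
  have hle : ∫ t in (0:ℝ)..(m - a), (deriv u (a + t) ^ 2 - u (a + t) ^ 2 / 4 * (t ^ 2)⁻¹) ≤
      ∫ t in a..m, (deriv u t ^ 2 - u t ^ 2 / 4 * w t) := by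
    have hs := intervalIntegral.integral_comp_add_left (a := 0) (b := m - a)
      (fun t => deriv u t ^ 2 - u t ^ 2 / 4 * w t) a
    rw [add_zero, add_sub_cancel] at hs
    rw [← hs]
    refine intervalIntegral.integral_mono_on_of_le_Ioo (sub_pos.2 ham).le hfint ?_ fun t ht => ?_
    · exact (hi.comp_add_left a).intervalIntegrable
    · have := hw (a + t) (by linarith [ht.1]) (by linarith [ht.2])
      rw [add_sub_cancel_left] at this
      gcongr
  refine ⟨h1.trans hle, fun x hx hxm => ?_⟩
  have := h2 (x - a) (by linarith) (by linarith)
  have hs := intervalIntegral.integral_comp_add_left (a := 0) (b := m - a)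
      (fun t => u t ^ (2 * p)) a
  rw [add_zero, add_sub_cancel] at hs
  rw [add_sub_cancel, hs] at this
  refine this.trans ?_
  gcongr

lemma half_interval_right (p : ℕ) {u w : ℝ → ℝ} (hu : ContDiff ℝ 1 u) {m b : ℝ} (hmb : m < b)
    (h0 : b ∉ tsupport u) (hw : ∀ t, m ≤ t → t < b → w t ≤ ((b - t) ^ 2)⁻¹)
    (hi : Integrable fun t => deriv u t ^ 2 - u t ^ 2 / 4 * w t) :
    0 ≤ ∫ t in m..b, (deriv u t ^ 2 - u t ^ 2 / 4 * w t) ∧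
    ∀ x, m ≤ x → x < b → |u x| ^ (p + 1) ≤ (2 ^ (p + 1) * (p + 2) + (p + 1)) *
      (√(∫ t in m..b, (deriv u t ^ 2 - u t ^ 2 / 4 * w t)) * √(∫ t in m..b, u t ^ (2 * p))) := by
  have hU : ContDiff ℝ 1 fun t => u (-t) := hu.comp contDiff_neg
  have hU0 : -b ∉ tsupport fun t => u (-t) := by
    rw [notMem_tsupport_iff_eventuallyEq] at h0 ⊢
    have : Filter.Tendsto (fun t : ℝ => -t) (nhds (-b)) (nhds b) :=
      Continuous.tendsto' (by fun_prop) _ _ (by simp)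
    exact this.eventually h0
  have hdn : ∀ t, deriv (fun t => u (-t)) t ^ 2 = deriv u (-t) ^ 2 := fun t => by
    rw [deriv_comp_neg]; ring
  obtain ⟨h1, h2⟩ := half_interval_left p hU (w := fun t => w (-t)) (neg_lt_neg hmb) hU0
    (fun t ht ht' => by
      have := hw (-t) (by linarith) (by linarith)
      rwa [show b - -t = t - -b by ring] at this)
    (by
      simp only [hdn]
      exact hi.comp_neg)
  simp only [hdn] at h1 h2
  rw [intervalIntegral.integral_comp_neg (fun t => deriv u t ^ 2 - u t ^ 2 / 4 * w t),
    neg_neg, neg_neg] at h1 h2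
  rw [intervalIntegral.integral_comp_neg (fun t => u t ^ (2 * p)), neg_neg, neg_neg] at h2
  refine ⟨h1, fun x hx hxb => ?_⟩
  simpa using h2 (-x) (by linarith) (by linarith)

lemma interval_estimate (p : ℕ) {u w : ℝ → ℝ} (hu : ContDiff ℝ 1 u) {a b : ℝ} (hab : a < b)
    (ha : a ∉ tsupport u) (hb : b ∉ tsupport u)
    (hw : ∀ t ∈ Ioo a b, w t ≤ (min (t - a) (b - t) ^ 2)⁻¹)
    (hi : Integrable (fun t => deriv u t ^ 2 - u t ^ 2 / 4 * w t)) :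
    0 ≤ ∫ t in Ioo a b, (deriv u t ^ 2 - u t ^ 2 / 4 * w t) ∧
    ∀ x ∈ Ioo a b, |u x| ^ (p + 1) ≤ (2 ^ (p + 1) * (p + 2) + (p + 1)) *
      (√(∫ t in Ioo a b, (deriv u t ^ 2 - u t ^ 2 / 4 * w t)) *
        √(∫ t in Ioo a b, u t ^ (2 * p))) := by
  obtain ⟨m, ham, hmb, hm⟩ : ∃ m, a < m ∧ m < b ∧ m - a = b - m :=
    ⟨(a + b) / 2, by linarith, by linarith, by ring⟩
  have hii : ∀ c d, IntervalIntegrable (fun t => deriv u t ^ 2 - u t ^ 2 / 4 * w t) volume c d :=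
    fun c d => hi.intervalIntegrable
  have hpi : ∀ c d, IntervalIntegrable (fun t => u t ^ (2 * p)) volume c d :=
    fun c d => (hu.continuous.pow _).intervalIntegrable _ _
  have hpow : ∀ t, 0 ≤ u t ^ (2 * p) := fun t => by rw [pow_mul]; positivity
  obtain ⟨hl, hl'⟩ := half_interval_left p hu ham ha (w := w) (fun t h1 h2 => by
    have := hw t ⟨h1, by linarith⟩
    rwa [min_eq_left (by linarith)] at this) hi
  obtain ⟨hr, hr'⟩ := half_interval_right p hu hmb hb (w := w) (fun t h1 h2 => by
    have := hw t ⟨by linarith, h2⟩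
    rwa [min_eq_right (by linarith)] at this) hi
  rw [← integral_Ioc_eq_integral_Ioo, ← integral_Ioc_eq_integral_Ioo,
    ← intervalIntegral.integral_of_le hab.le, ← intervalIntegral.integral_of_le hab.le,
    ← intervalIntegral.integral_add_adjacent_intervals (hii a m) (hii m b),
    ← intervalIntegral.integral_add_adjacent_intervals (hpi a m) (hpi m b)]
  have hUl : 0 ≤ ∫ t in a..m, u t ^ (2 * p) :=
    intervalIntegral.integral_nonneg ham.le fun t _ => hpow t
  have hUr : 0 ≤ ∫ t in m..b, u t ^ (2 * p) :=
    intervalIntegral.integral_nonneg hmb.le fun t _ => hpow t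
  refine ⟨by positivity, fun x hx => ?_⟩
  rcases le_total x m with h | h
  · refine (hl' x hx.1 h).trans ?_
    gcongr <;> linarith
  · refine (hr' x h hx.2).trans ?_
    gcongr <;> linarith

/-- A bounded open subset of the line is a countable union of disjoint intervals whose endpoints
lie outside of it; this is the family of pairs of endpoints. -/
def gapPairs (O : Set ℝ) : Set (ℝ × ℝ) :=
  {c | c.1 < c.2 ∧ c.1 ∉ O ∧ c.2 ∉ O ∧ Ioo c.1 c.2 ⊆ O}

lemma gapPairs_pairwiseDisjoint (O : Set ℝ) :
    (gapPairs O).PairwiseDisjoint fun c => Ioo c.1 c.2 := by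
  rintro ⟨a, b⟩ ⟨-, ha, hb, hab⟩ ⟨a', b'⟩ ⟨-, ha', hb', hab'⟩ hne
  simp only [Function.onFun, Set.disjoint_left]
  rintro z ⟨h1, h2⟩ ⟨h3, h4⟩
  simp only at *
  apply hne
  have e1 : a = a' := by
    rcases lt_trichotomy a a' with h | h | h
    · exact absurd (hab ⟨h, h3.trans h2⟩) ha'
    · exact h
    · exact absurd (hab' ⟨h, h1.trans h4⟩) ha
  have e2 : b = b' := by
    rcases lt_trichotomy b b' with h | h | h
    · exact absurd (hab' ⟨h3.trans h2, h⟩) hb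
    · exact h
    · exact absurd (hab ⟨h1.trans h4, h⟩) hb'
  rw [e1, e2]

lemma gapPairs_countable (O : Set ℝ) : (gapPairs O).Countable :=
  (gapPairs_pairwiseDisjoint O).countable_of_isOpen (fun _ _ => isOpen_Ioo)
    fun _ hc => nonempty_Ioo.2 hc.1

lemma exists_mem_gapPairs {O : Set ℝ} (hO : IsOpen O) {R x : ℝ} (hR : O ⊆ Ioo (-R) R)
    (hx : x ∈ O) : ∃ c ∈ gapPairs O, x ∈ Ioo c.1 c.2 := by
  have hxR := hR hx
  have hA : sSup (Oᶜ ∩ Iic x) ∈ Oᶜ ∩ Iic x :=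
    (hO.isClosed_compl.inter isClosed_Iic).csSup_mem
      ⟨-R, fun h => (lt_irrefl _ (hR h).1), hxR.1.le⟩ ⟨x, fun y hy => hy.2⟩
  have hB : sInf (Oᶜ ∩ Ici x) ∈ Oᶜ ∩ Ici x :=
    (hO.isClosed_compl.inter isClosed_Ici).csInf_mem
      ⟨R, fun h => (lt_irrefl _ (hR h).2), hxR.2.le⟩ ⟨x, fun y hy => hy.2⟩
  have h1 : sSup (Oᶜ ∩ Iic x) < x := lt_of_le_of_ne hA.2 fun h => hA.1 (by rwa [h])
  have h2 : x < sInf (Oᶜ ∩ Ici x) := lt_of_le_of_ne hB.2 fun h => hB.1 (by rwa [← h])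
  refine ⟨(sSup (Oᶜ ∩ Iic x), sInf (Oᶜ ∩ Ici x)), ⟨h1.trans h2, hA.1, hB.1, fun y hy => ?_⟩,
    h1, h2⟩
  by_contra hyO
  rcases le_total y x with h | h
  · exact absurd (le_csSup (s := Oᶜ ∩ Iic x) ⟨x, fun y hy => hy.2⟩ ⟨hyO, h⟩) (not_le.2 hy.1)
  · exact absurd (csInf_le (s := Oᶜ ∩ Ici x) ⟨x, fun y hy => hy.2⟩ ⟨hyO, h⟩) (not_le.2 hy.2)

/-- One-dimensional Hardy inequality with a sup-norm remainder on an arbitrary open set. -/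
lemma line_estimate (p : ℕ) (hp : 1 ≤ p) {u w : ℝ → ℝ} (hu : ContDiff ℝ 1 u)
    (hc : HasCompactSupport u) {O : Set ℝ} (hO : IsOpen O) (huO : tsupport u ⊆ O)
    (hw : ∀ a b t, Ioo a b ⊆ O → t ∈ Ioo a b → w t ≤ (min (t - a) (b - t) ^ 2)⁻¹)
    (hi : Integrable fun t => u t ^ 2 * w t) :
    0 ≤ ∫ t, (deriv u t ^ 2 - u t ^ 2 / 4 * w t) ∧
    ∀ x, |u x| ^ (p + 1) ≤ (2 ^ (p + 1) * (p + 2) + (p + 1)) *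
      (√(∫ t, (deriv u t ^ 2 - u t ^ 2 / 4 * w t)) * √(∫ t, u t ^ (2 * p))) := by
  obtain ⟨R, hR⟩ : ∃ R : ℝ, tsupport u ⊆ Ioo (-R) R := by
    obtain ⟨R, hR⟩ := hc.isCompact.isBounded.subset_ball (0 : ℝ)
    refine ⟨R, hR.trans ?_⟩
    rw [Real.ball_eq_Ioo]; simp
  set O' := O ∩ Ioo (-R) R with hO'
  have hO'o : IsOpen O' := hO.inter isOpen_Ioo
  have huO' : tsupport u ⊆ O' := subset_inter huO hR
  set f : ℝ → ℝ := fun t => deriv u t ^ 2 - u t ^ 2 / 4 * w t with hf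
  have hd : Continuous (deriv u) := hu.continuous_deriv le_rfl
  have hfi : Integrable f := by
    have h1 : Integrable fun t => deriv u t ^ 2 := by
      refine Continuous.integrable_of_hasCompactSupport (by fun_prop) ?_
      exact hc.deriv.comp_left (g := fun y : ℝ => y ^ 2) (by simp)
    refine h1.sub ((hi.const_mul (1 / 4)).congr (ae_of_all _ fun t => ?_))
    ring
  have hpi : Integrable fun t => u t ^ (2 * p) := by
    refine Continuous.integrable_of_hasCompactSupport (hu.continuous.pow _) ?_
    exact hc.comp_left (g := fun y : ℝ => y ^ (2 * p)) (zero_pow (by omega))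
  have hpow : ∀ t, 0 ≤ u t ^ (2 * p) := fun t => by rw [pow_mul]; positivity
  have := (gapPairs_countable O').to_subtype
  have hU : ⋃ c : gapPairs O', Ioo c.1.1 c.1.2 = O' := by
    ext x
    simp only [mem_iUnion]
    constructor
    · rintro ⟨c, hx⟩
      exact c.2.2.2.2 hx
    · intro hx
      obtain ⟨c, h, hxc⟩ := exists_mem_gapPairs hO'o inter_subset_right hx
      exact ⟨⟨c, h⟩, hxc⟩
  have hsum := hasSum_integral_iUnion (μ := volume) (f := f)
    (s := fun c : gapPairs O' => Ioo c.1.1 c.1.2) (fun _ => measurableSet_Ioo)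
    (fun c d hcd => gapPairs_pairwiseDisjoint O' c.2 d.2 fun h => hcd (Subtype.ext h))
    hfi.integrableOn
  rw [hU] at hsum
  have hfint : ∫ t in O', f t = ∫ t, f t := by
    refine setIntegral_eq_integral_of_forall_compl_eq_zero fun t ht => ?_
    have ht' : t ∉ tsupport u := fun h => ht (huO' h)
    have h1 : deriv u t = 0 := by
      by_contra h
      exact ht' (support_deriv_subset h)
    simp [hf, h1, image_eq_zero_of_notMem_tsupport ht']
  rw [hfint] at hsum
  have hest := fun c : gapPairs O' => interval_estimate p hu c.2.1
    (fun h => c.2.2.1 (huO' h)) (fun h => c.2.2.2.1 (huO' h))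
    (fun t ht => hw c.1.1 c.1.2 t (c.2.2.2.2.trans inter_subset_left) ht) hfi
  refine ⟨hsum.nonneg fun c => (hest c).1, fun x => ?_⟩
  by_cases hx : x ∈ tsupport u
  · obtain ⟨c, h, hxc⟩ := exists_mem_gapPairs hO'o inter_subset_right (huO' hx)
    refine ((hest ⟨c, h⟩).2 x hxc).trans ?_
    have h1 := le_hasSum hsum ⟨c, h⟩ fun d _ => (hest d).1
    have h2 : ∫ t in Ioo c.1 c.2, u t ^ (2 * p) ≤ ∫ t, u t ^ (2 * p) :=
      setIntegral_le_integral hpi (ae_of_all _ hpow)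
    dsimp only at h1 ⊢
    gcongr
  · rw [image_eq_zero_of_notMem_tsupport hx, abs_zero, zero_pow (by omega)]
    positivity

/-- The inverse square of the directional distance to the complement. -/
noncomputable def dirWeight {N : ℕ} (Ω : Set (EuclideanSpace ℝ (Fin N)))
    (x e : EuclideanSpace ℝ (Fin N)) : ℝ :=
  (dirDist Ω x e ^ 2)⁻¹

section dirWeight

variable {N : ℕ} {Ω : Set (EuclideanSpace ℝ (Fin N))} {x e : EuclideanSpace ℝ (Fin N)}

lemma dirWeight_nonneg : 0 ≤ dirWeight Ω x e := by unfold dirWeight; positivity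

lemma dirDist_le {t : ℝ} (ht : x + t • e ∈ Ωᶜ) : dirDist Ω x e ≤ |t| :=
  csInf_le ⟨0, by rintro r ⟨t, rfl, -⟩; positivity⟩ ⟨t, rfl, ht⟩

/-- The directional distance is attained, unless the line does not leave the set. -/
lemma dirWeight_eq_zero_or (hΩ : IsOpen Ω) (x e : EuclideanSpace ℝ (Fin N)) :
    (dirWeight Ω x e = 0 ∧ ∀ t : ℝ, x + t • e ∉ Ωᶜ) ∨
      ∃ t : ℝ, x + t • e ∈ Ωᶜ ∧ dirDist Ω x e = |t| := by
  have hcl : IsClosed {r : ℝ | ∃ t : ℝ, r = |t| ∧ x + t • e ∈ Ωᶜ} := by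
    have : {r : ℝ | ∃ t : ℝ, r = |t| ∧ x + t • e ∈ Ωᶜ} =
        Ici 0 ∩ ((fun r : ℝ => x + r • e) ⁻¹' Ωᶜ ∪ (fun r : ℝ => x + (-r) • e) ⁻¹' Ωᶜ) := by
      ext r
      constructor
      · rintro ⟨t, rfl, ht⟩
        refine ⟨abs_nonneg t, ?_⟩
        rcases abs_cases t with ⟨h, -⟩ | ⟨h, -⟩
        · left; rw [h]; exact ht
        · right; rw [h]; simpa using ht
      · rintro ⟨h0, h | h⟩
        · exact ⟨r, (abs_of_nonneg h0).symm, h⟩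
        · exact ⟨-r, by rw [abs_neg, abs_of_nonneg h0], h⟩
    rw [this]
    exact isClosed_Ici.inter ((hΩ.isClosed_compl.preimage (by fun_prop)).union
      (hΩ.isClosed_compl.preimage (by fun_prop)))
  rcases Set.eq_empty_or_nonempty {r : ℝ | ∃ t : ℝ, r = |t| ∧ x + t • e ∈ Ωᶜ} with h | h
  · left
    refine ⟨by rw [dirWeight, dirDist, h, Real.sInf_empty]; simp, fun t ht => ?_⟩
    exact (Set.eq_empty_iff_forall_notMem.1 h) |t| ⟨t, rfl, ht⟩
  · right
    obtain ⟨t, h1, h2⟩ := hcl.csInf_mem h ⟨0, by rintro r ⟨t, rfl, -⟩; positivity⟩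
    exact ⟨t, h2, h1⟩

lemma le_dirWeight_iff (hΩ : IsOpen Ω) (hx : x ∈ Ω) {c : ℝ} (hc : 0 < c) :
    c ≤ dirWeight Ω x e ↔ ∃ t ∈ Icc (-(√c)⁻¹) (√c)⁻¹, x + t • e ∈ Ωᶜ := by
  have hs := Real.sqrt_pos.2 hc
  have key : ∀ d : ℝ, 0 < d → (c ≤ (d ^ 2)⁻¹ ↔ d ≤ (√c)⁻¹) := by
    intro d hd
    rw [le_inv_comm₀ hc (by positivity), ← Real.sqrt_inv, Real.le_sqrt' hd]
  rcases dirWeight_eq_zero_or hΩ x e with ⟨h0, h⟩ | ⟨t, ht, hd⟩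
  · rw [h0]
    constructor
    · intro h'; linarith
    · rintro ⟨t, -, ht⟩; exact absurd ht (h t)
  · have hd0 : 0 < dirDist Ω x e := by
      rw [hd, abs_pos]
      rintro rfl
      exact ht (by simpa using hx)
    rw [dirWeight, key _ hd0]
    constructor
    · intro h
      rw [hd] at h
      exact ⟨t, abs_le.1 h, ht⟩
    · rintro ⟨s, hs, hs'⟩
      exact (dirDist_le hs').trans (abs_le.2 hs)

lemma measurable_dirWeight (hΩ : IsOpen Ω) :
    Measurable fun z : EuclideanSpace ℝ (Fin N) × EuclideanSpace ℝ (Fin N) =>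
      dirWeight Ω z.1 z.2 := by
  refine measurable_of_Ici fun c => ?_
  rcases le_or_gt c 0 with hc | hc
  · have : (fun z : EuclideanSpace ℝ (Fin N) × EuclideanSpace ℝ (Fin N) =>
      dirWeight Ω z.1 z.2) ⁻¹' Ici c = univ :=
      eq_univ_of_forall fun z => hc.trans dirWeight_nonneg
    rw [this]; exact MeasurableSet.univ
  · have hclosed : IsClosed (Prod.snd ''
        {y : Icc (-(√c)⁻¹) (√c)⁻¹ × (EuclideanSpace ℝ (Fin N) × EuclideanSpace ℝ (Fin N)) |
          y.2.1 + (y.1 : ℝ) • y.2.2 ∈ Ωᶜ}) :=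
      isClosedMap_snd_of_compactSpace _ (hΩ.isClosed_compl.preimage (by fun_prop))
    have : (fun z : EuclideanSpace ℝ (Fin N) × EuclideanSpace ℝ (Fin N) =>
        dirWeight Ω z.1 z.2) ⁻¹' Ici c = (Prod.fst ⁻¹' Ω) ∩ (Prod.snd ''
        {y : Icc (-(√c)⁻¹) (√c)⁻¹ × (EuclideanSpace ℝ (Fin N) × EuclideanSpace ℝ (Fin N)) |
          y.2.1 + (y.1 : ℝ) • y.2.2 ∈ Ωᶜ}) := by
      ext ⟨x, e⟩
      simp only [mem_preimage, mem_Ici, mem_inter_iff, mem_image, mem_ofPred_eq]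
      by_cases hx : x ∈ Ω
      · rw [le_dirWeight_iff hΩ hx hc]
        constructor
        · rintro ⟨t, ht, h⟩
          exact ⟨hx, (⟨t, ht⟩, (x, e)), h, rfl⟩
        · rintro ⟨-, ⟨t, y⟩, h, rfl⟩
          exact ⟨t, t.2, h⟩
      · have h0 : dirDist Ω x e = 0 := le_antisymm
          (by simpa using dirDist_le (t := 0) (e := e) (by simpa using hx))
          (Real.sInf_nonneg (by rintro r ⟨t, rfl, -⟩; positivity))
        simp [dirWeight, h0, hx, hc]
    rw [this]
    exact (hΩ.preimage continuous_fst).measurableSet.inter hclosed.measurableSet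

lemma exists_dirWeight_le (hΩ : IsOpen Ω) {K : Set (EuclideanSpace ℝ (Fin N))}
    (hK : IsCompact K) (hKΩ : K ⊆ Ω) :
    ∃ M, 0 ≤ M ∧ ∀ x ∈ K, ∀ e : EuclideanSpace ℝ (Fin N), ‖e‖ = 1 → dirWeight Ω x e ≤ M := by
  obtain ⟨δ, hδ, h⟩ := hK.exists_thickening_subset_open hΩ hKΩ
  refine ⟨(δ ^ 2)⁻¹, by positivity, fun x hx e he => ?_⟩
  rcases dirWeight_eq_zero_or hΩ x e with ⟨h0, -⟩ | ⟨t, ht, hd⟩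
  · rw [h0]; positivity
  · rw [dirWeight, hd]
    have : δ ≤ |t| := by
      by_contra! hlt
      refine ht (h (mem_thickening_iff.2 ⟨x, hx, ?_⟩))
      simpa [dist_eq_norm, norm_smul, he] using hlt
    gcongr

lemma dirWeight_le_of_Ioo (hΩ : IsOpen Ω) {a b t : ℝ}
    (hab : Ioo a b ⊆ {s : ℝ | x + s • e ∈ Ω}) (ht : t ∈ Ioo a b) :
    dirWeight Ω (x + t • e) e ≤ (min (t - a) (b - t) ^ 2)⁻¹ := by
  rcases dirWeight_eq_zero_or hΩ (x + t • e) e with ⟨h0, -⟩ | ⟨s, hs, hd⟩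
  · rw [h0]; positivity
  · have h1 : 0 < min (t - a) (b - t) := lt_min (by linarith [ht.1]) (by linarith [ht.2])
    rw [dirWeight, hd]
    have : min (t - a) (b - t) ≤ |s| := by
      by_contra! hlt
      obtain ⟨h2, h3⟩ := lt_min_iff.1 hlt
      have h4 := abs_lt.1 h2
      have h5 := abs_lt.1 h3
      refine hs ?_
      have := hab (show t + s ∈ Ioo a b from ⟨by linarith, by linarith⟩)
      rwa [mem_ofPred_eq, add_smul, ← add_assoc] at this
    gcongr

end dirWeight

/-- The Hardy energy density in a given direction. -/
noncomputable def dirDensity {N : ℕ} (Ω : Set (EuclideanSpace ℝ (Fin N)))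
    (u : EuclideanSpace ℝ (Fin N) → ℝ) (x e : EuclideanSpace ℝ (Fin N)) : ℝ :=
  fderiv ℝ u x e ^ 2 - u x ^ 2 / 4 * dirWeight Ω x e

section density

variable {N : ℕ} {Ω : Set (EuclideanSpace ℝ (Fin N))} {u : EuclideanSpace ℝ (Fin N) → ℝ}

lemma integrable_sq_mul_dirWeight (hΩ : IsOpen Ω) (hu : ContDiff ℝ 1 u)
    (hc : HasCompactSupport u) (huΩ : tsupport u ⊆ Ω) {X : Type*} [MeasurableSpace X]
    {μ : Measure X} {φ ψ : X → EuclideanSpace ℝ (Fin N)} (hφ : Measurable φ) (hψ : Measurable ψ)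
    (hψ1 : ∀ x, ‖ψ x‖ = 1) (hμ : μ (φ ⁻¹' tsupport u) < ⊤) :
    Integrable (fun x => u (φ x) ^ 2 * dirWeight Ω (φ x) (ψ x)) μ := by
  obtain ⟨M, hM0, hM⟩ := exists_dirWeight_le hΩ hc.isCompact huΩ
  obtain ⟨B, hB⟩ := hc.exists_bound_of_continuous hu.continuous
  have hmeas : MeasurableSet (φ ⁻¹' tsupport u) :=
    hφ (isClosed_tsupport u).measurableSet
  have hg : Integrable ((φ ⁻¹' tsupport u).indicator fun _ => B ^ 2 * M) μ :=
    (integrable_indicator_iff hmeas).2 (integrableOn_const hμ.ne)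
  refine hg.mono' ?_ (ae_of_all _ fun x => ?_)
  · exact (((hu.continuous.measurable.comp hφ).pow_const 2).mul
      ((measurable_dirWeight hΩ).comp (hφ.prodMk hψ))).aestronglyMeasurable
  · rw [Real.norm_of_nonneg (mul_nonneg (sq_nonneg _) dirWeight_nonneg)]
    by_cases hx : x ∈ φ ⁻¹' tsupport u
    · rw [indicator_of_mem hx]
      have h1 : u (φ x) ^ 2 ≤ B ^ 2 := by
        rw [← sq_abs]; gcongr; exact hB _
      exact mul_le_mul h1 (hM _ hx _ (hψ1 x)) dirWeight_nonneg (by positivity)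
    · rw [indicator_of_notMem hx, image_eq_zero_of_notMem_tsupport hx]
      simp

lemma integrable_dirDensity (hΩ : IsOpen Ω) (hu : ContDiff ℝ 1 u)
    (hc : HasCompactSupport u) (huΩ : tsupport u ⊆ Ω) {X : Type*} [MeasurableSpace X]
    {μ : Measure X} {φ ψ : X → EuclideanSpace ℝ (Fin N)} (hφ : Measurable φ) (hψ : Measurable ψ)
    (hψ1 : ∀ x, ‖ψ x‖ = 1) (hμ : μ (φ ⁻¹' tsupport u) < ⊤) :
    Integrable (fun x => dirDensity Ω u (φ x) (ψ x)) μ := by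
  have hfd : Continuous (fderiv ℝ u) := hu.continuous_fderiv one_ne_zero
  have h2 := integrable_sq_mul_dirWeight hΩ hu hc huΩ hφ hψ hψ1 hμ
  have h1 : Integrable (fun x => fderiv ℝ u (φ x) (ψ x) ^ 2) μ := by
    obtain ⟨B, hB⟩ := (hc.fderiv ℝ).exists_bound_of_continuous hfd
    have hmeas : MeasurableSet (φ ⁻¹' tsupport u) :=
      hφ (isClosed_tsupport u).measurableSet
    have hg : Integrable ((φ ⁻¹' tsupport u).indicator fun _ => B ^ 2) μ :=
      (integrable_indicator_iff hmeas).2 (integrableOn_const hμ.ne)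
    refine hg.mono' ?_ (ae_of_all _ fun x => ?_)
    · have : Continuous fun z : EuclideanSpace ℝ (Fin N) × EuclideanSpace ℝ (Fin N) =>
        fderiv ℝ u z.1 z.2 := by fun_prop
      exact ((this.measurable.comp (hφ.prodMk hψ)).pow_const 2).aestronglyMeasurable
    · rw [Real.norm_of_nonneg (sq_nonneg _)]
      by_cases hx : x ∈ φ ⁻¹' tsupport u
      · rw [indicator_of_mem hx, ← sq_abs]
        have := (fderiv ℝ u (φ x)).le_opNorm (ψ x)
        rw [hψ1, mul_one, Real.norm_eq_abs] at this
        have := this.trans (hB (φ x))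
        gcongr
      · have : fderiv ℝ u (φ x) = 0 := by
          by_contra h
          exact hx (support_fderiv_subset ℝ h)
        rw [indicator_of_notMem hx, this]
        simp
  refine h1.sub ((h2.const_mul (1 / 4)).congr (ae_of_all _ fun t => ?_))
  ring

lemma dirDensity_line_estimate (p : ℕ) (hp : 1 ≤ p) (hΩ : IsOpen Ω) (hu : ContDiff ℝ 1 u)
    (hc : HasCompactSupport u) (huΩ : tsupport u ⊆ Ω) (x₀ : EuclideanSpace ℝ (Fin N))
    {e : EuclideanSpace ℝ (Fin N)} (he : ‖e‖ = 1) :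
    0 ≤ ∫ t : ℝ, dirDensity Ω u (x₀ + t • e) e ∧
    ∀ t : ℝ, |u (x₀ + t • e)| ^ (p + 1) ≤ (2 ^ (p + 1) * (p + 2) + (p + 1)) *
      (√(∫ t : ℝ, dirDensity Ω u (x₀ + t • e) e) * √(∫ t : ℝ, u (x₀ + t • e) ^ (2 * p))) := by
  set φ : ℝ → EuclideanSpace ℝ (Fin N) := fun t => x₀ + t • e with hφ
  have hφc : Continuous φ := by fun_prop
  have hφd : ∀ t, HasDerivAt φ e t := fun t => by
    exact (((hasDerivAt_id t).smul_const e).const_add x₀).congr_deriv (one_smul _ _)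
  have hφiso : Isometry φ := by
    refine Isometry.of_dist_eq fun s t => ?_
    simp [hφ, dist_eq_norm, ← sub_smul, norm_smul, he]
  have hcpt : IsCompact (φ ⁻¹' tsupport u) :=
    hφiso.isClosedEmbedding.isCompact_preimage hc.isCompact
  have hts : tsupport (fun t => u (φ t)) ⊆ φ ⁻¹' tsupport u :=
    closure_minimal (fun t ht => subset_tsupport u ht)
      ((isClosed_tsupport u).preimage hφc)
  have hder : ∀ t, deriv (fun t => u (φ t)) t = fderiv ℝ u (φ t) e := fun t =>
    ((hu.differentiable one_ne_zero (φ t)).hasFDerivAt.comp_hasDerivAt t (hφd t)).deriv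
  have := line_estimate p hp (u := fun t => u (φ t)) (w := fun t => dirWeight Ω (φ t) e)
    (O := φ ⁻¹' Ω) (hu.comp (by fun_prop)) (hcpt.of_isClosed_subset (isClosed_tsupport _) hts)
    (hΩ.preimage hφc) (hts.trans (preimage_mono huΩ))
    (fun a b t hab ht => dirWeight_le_of_Ioo hΩ hab ht)
    (integrable_sq_mul_dirWeight hΩ hu hc huΩ hφc.measurable measurable_const (fun _ => he)
      hcpt.measure_lt_top)
  simp only [hder] at this
  exact this

end density

lemma norm_sq_eq_sum_sq {ι E : Type*} [Fintype ι] [NormedAddCommGroup E]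
    [InnerProductSpace ℝ E] [CompleteSpace E] (b : OrthonormalBasis ι ℝ E) (L : E →L[ℝ] ℝ) :
    ‖L‖ ^ 2 = ∑ i, L (b i) ^ 2 := by
  have h := b.sum_sq_norm_inner_right ((InnerProductSpace.toDual ℝ E).symm L)
  rw [LinearIsometryEquiv.norm_map] at h
  rw [← h]
  refine Finset.sum_congr rfl fun i _ => ?_
  rw [real_inner_comm, InnerProductSpace.toDual_symm_apply, Real.norm_eq_abs, sq_abs]

/-- The restriction of a linear isometry to the unit sphere. -/
def sphereMap {E : Type*} [NormedAddCommGroup E] [NormedSpace ℝ E] (T : E ≃ₗᵢ[ℝ] E)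
    (e : sphere (0 : E) 1) : sphere (0 : E) 1 :=
  ⟨T e, by simp⟩

open scoped Pointwise in
lemma measurePreserving_sphereMap {E : Type*} [NormedAddCommGroup E] [InnerProductSpace ℝ E]
    [FiniteDimensional ℝ E] [MeasurableSpace E] [BorelSpace E] (T : E ≃ₗᵢ[ℝ] E) :
    MeasurePreserving (sphereMap T) (volume : Measure E).toSphere
      (volume : Measure E).toSphere := by
  have hc : Continuous (sphereMap T) := by
    unfold sphereMap; fun_prop
  refine ⟨hc.measurable, Measure.ext fun s hs => ?_⟩
  rw [Measure.map_apply hc.measurable hs, Measure.toSphere_apply' _ hs,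
    Measure.toSphere_apply' _ (hc.measurable hs)]
  congr 1
  have : Ioo (0:ℝ) 1 • ((↑) '' (sphereMap T ⁻¹' s) : Set E) =
      T ⁻¹' (Ioo (0:ℝ) 1 • ((↑) '' s : Set E)) := by
    ext x
    simp only [Set.mem_smul, mem_image, mem_preimage]
    constructor
    · rintro ⟨r, hr, _, ⟨e, he, rfl⟩, rfl⟩
      exact ⟨r, hr, _, ⟨_, he, rfl⟩, by simp [sphereMap]⟩
    · rintro ⟨r, hr, _, ⟨e, he, rfl⟩, h⟩
      refine ⟨r, hr, _, ⟨sphereMap T.symm e, ?_, rfl⟩, ?_⟩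
      · simpa [sphereMap] using he
      · apply T.injective
        simp [sphereMap, h]
  rw [this]
  exact T.measurePreserving.measure_preimage_equiv (f := T.toHomeomorph.toMeasurableEquiv) _

/-- Rotation of the plane by a right angle. -/
noncomputable def planeRot : EuclideanSpace ℝ (Fin 2) ≃ₗᵢ[ℝ] EuclideanSpace ℝ (Fin 2) :=
  LinearIsometry.toLinearIsometryEquiv
    { toFun := fun x => !₂[-x 1, x 0]
      map_add' := fun x y => by
        ext i; fin_cases i <;> simp [add_comm]
      map_smul' := fun c x => by
        ext i; fin_cases i <;> simp
      norm_map' := fun x => by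
        simp [EuclideanSpace.norm_eq, Fin.sum_univ_two, add_comm] } rfl

lemma inner_planeRot (x : EuclideanSpace ℝ (Fin 2)) : inner ℝ x (planeRot x) = 0 := by
  simp [planeRot, PiLp.inner_apply, Fin.sum_univ_two, mul_comm]

lemma exists_orthonormalBasis_line {e : EuclideanSpace ℝ (Fin 1)} (he : ‖e‖ = 1) :
    ∃ b : OrthonormalBasis (Fin 1) ℝ (EuclideanSpace ℝ (Fin 1)), b 0 = e := by
  have hv : Orthonormal ℝ (univ.domRestrict fun _ : Fin 1 => e) :=
    ⟨fun _ => he, fun i j hij => absurd (Subtype.ext (Subsingleton.elim _ _)) hij⟩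
  obtain ⟨b, hb⟩ := hv.exists_orthonormalBasis_extension_of_card_eq (by simp)
  exact ⟨b, hb 0 (mem_univ _)⟩

lemma exists_orthonormalBasis_plane {e : EuclideanSpace ℝ (Fin 2)} (he : ‖e‖ = 1) :
    ∃ b : OrthonormalBasis (Fin 2) ℝ (EuclideanSpace ℝ (Fin 2)), b 0 = e ∧ b 1 = planeRot e := by
  have hv : Orthonormal ℝ ![e, planeRot e] := by
    constructor
    · intro i; fin_cases i <;> simp [he]
    · intro i j hij
      fin_cases i <;> fin_cases j <;> simp_all [inner_planeRot, real_inner_comm]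
  have hv' : Orthonormal ℝ ((univ : Set (Fin 2)).domRestrict ![e, planeRot e]) :=
    hv.comp (fun i : (univ : Set (Fin 2)) => (i : Fin 2)) Subtype.val_injective
  obtain ⟨b, hb⟩ := Orthonormal.exists_orthonormalBasis_extension_of_card_eq (𝕜 := ℝ)
    (ι := Fin 2) (by simp) hv'
  exact ⟨b, hb 0 (mem_univ _), hb 1 (mem_univ _)⟩

lemma average_sphereMap {E : Type*} [NormedAddCommGroup E] [InnerProductSpace ℝ E]
    [FiniteDimensional ℝ E] [MeasurableSpace E] [BorelSpace E] (T : E ≃ₗᵢ[ℝ] E)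
    {f : sphere (0 : E) 1 → ℝ} (hf : Integrable f (volume : Measure E).toSphere) :
    ⨍ e, f (sphereMap T e) ∂(volume : Measure E).toSphere =
      ⨍ e, f e ∂(volume : Measure E).toSphere := by
  have h := measurePreserving_sphereMap T
  rw [average_eq, average_eq]
  congr 1
  conv_rhs => rw [← h.map_eq]
  rw [integral_map h.measurable.aemeasurable (by rw [h.map_eq]; exact hf.aestronglyMeasurable)]

lemma integrable_sq_apply_sphere {N : ℕ} (L : EuclideanSpace ℝ (Fin N) →L[ℝ] ℝ) :
    Integrable (fun e : sphere (0 : EuclideanSpace ℝ (Fin N)) 1 => L e ^ 2)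
      (volume : Measure (EuclideanSpace ℝ (Fin N))).toSphere := by
  have hc : Continuous fun e : sphere (0 : EuclideanSpace ℝ (Fin N)) 1 => L e ^ 2 := by fun_prop
  exact hc.integrable_of_hasCompactSupport (HasCompactSupport.of_compactSpace _)

/-- Isotropy of the uniform measure on the sphere. -/
lemma mul_average_sq_apply {N : ℕ} (hN : N = 1 ∨ N = 2) (L : EuclideanSpace ℝ (Fin N) →L[ℝ] ℝ) :
    (N : ℝ) * ⨍ e : sphere (0 : EuclideanSpace ℝ (Fin N)) 1, L e ^ 2 ∂volume.toSphere =
      ‖L‖ ^ 2 := by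
  rcases hN with rfl | rfl
  · have h : ∀ e : sphere (0 : EuclideanSpace ℝ (Fin 1)) 1, L e ^ 2 = ‖L‖ ^ 2 := fun e => by
      obtain ⟨b, hb⟩ := exists_orthonormalBasis_line (e := e) (by simp)
      rw [norm_sq_eq_sum_sq b, Fin.sum_univ_one, hb]
    have : NeZero (volume : Measure (EuclideanSpace ℝ (Fin 1))).toSphere :=
      ⟨Measure.toSphere_ne_zero _⟩
    rw [show (fun e : sphere (0 : EuclideanSpace ℝ (Fin 1)) 1 => L e ^ 2) = fun _ => ‖L‖ ^ 2 from
      funext h, average_const]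
    simp
  · have h : ∀ e : sphere (0 : EuclideanSpace ℝ (Fin 2)) 1,
        L e ^ 2 + L (sphereMap planeRot e) ^ 2 = ‖L‖ ^ 2 := fun e => by
      obtain ⟨b, hb, hb'⟩ := exists_orthonormalBasis_plane (e := e) (by simp)
      rw [norm_sq_eq_sum_sq b, Fin.sum_univ_two, hb, hb']
      rfl
    have : NeZero (volume : Measure (EuclideanSpace ℝ (Fin 2))).toSphere :=
      ⟨Measure.toSphere_ne_zero _⟩
    have hi := integrable_sq_apply_sphere L
    have h2 := average_sphereMap planeRot hi
    have hi2 : Integrable (fun e => L (sphereMap planeRot e) ^ 2) _ :=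
      (measurePreserving_sphereMap planeRot).integrable_comp_of_integrable hi
    calc ((2 : ℕ) : ℝ) * ⨍ e : sphere (0 : EuclideanSpace ℝ (Fin 2)) 1, L e ^ 2 ∂volume.toSphere
        = (⨍ e : sphere (0 : EuclideanSpace ℝ (Fin 2)) 1, L e ^ 2 ∂volume.toSphere) +
          ⨍ e : sphere (0 : EuclideanSpace ℝ (Fin 2)) 1,
            L (sphereMap planeRot e) ^ 2 ∂volume.toSphere := by rw [h2]; push_cast; ring
      _ = ⨍ e : sphere (0 : EuclideanSpace ℝ (Fin 2)) 1, ‖L‖ ^ 2 ∂volume.toSphere := by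
          rw [average_eq, average_eq, ← smul_add]
          rw [← integral_add hi hi2, average_eq]
          simp only [h]
      _ = ‖L‖ ^ 2 := average_const _ _

section energy

variable {N : ℕ} {Ω : Set (EuclideanSpace ℝ (Fin N))} {u : EuclideanSpace ℝ (Fin N) → ℝ}

lemma inv_daviesWeight_sq (x : EuclideanSpace ℝ (Fin N)) :
    (daviesWeight Ω x ^ 2)⁻¹ = (N : ℝ) * ⨍ e : sphere (0 : EuclideanSpace ℝ (Fin N)) 1,
      dirWeight Ω x e ∂volume.toSphere := by
  have h : 0 ≤ (N : ℝ) * ⨍ e : sphere (0 : EuclideanSpace ℝ (Fin N)) 1,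
      dirWeight Ω x e ∂volume.toSphere := by
    rw [average_eq]
    exact mul_nonneg (by positivity) (smul_nonneg (by positivity)
      (integral_nonneg fun _ => dirWeight_nonneg))
  simp only [dirWeight] at h ⊢
  rw [daviesWeight, ← Real.rpow_natCast, ← Real.rpow_mul h]
  norm_num [Real.rpow_neg_one]

lemma integrable_dirDensity_prod (hΩ : IsOpen Ω) (hu : ContDiff ℝ 1 u)
    (hc : HasCompactSupport u) (huΩ : tsupport u ⊆ Ω) :
    Integrable (fun z : EuclideanSpace ℝ (Fin N) × sphere (0 : EuclideanSpace ℝ (Fin N)) 1 =>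
      dirDensity Ω u z.1 z.2) (volume.prod (volume : Measure _).toSphere) := by
  refine integrable_dirDensity hΩ hu hc huΩ measurable_fst
    (measurable_subtype_coe.comp measurable_snd) (fun z => by simp) ?_
  rw [← prod_univ, Measure.prod_prod]
  exact ENNReal.mul_lt_top hc.isCompact.measure_lt_top (measure_lt_top _ _)

lemma density_eq_average (hN : N = 1 ∨ N = 2) (hΩ : IsOpen Ω) (hu : ContDiff ℝ 1 u)
    (hc : HasCompactSupport u) (huΩ : tsupport u ⊆ Ω) (x : EuclideanSpace ℝ (Fin N)) :
    ‖fderiv ℝ u x‖ ^ 2 - u x ^ 2 / (4 * daviesWeight Ω x ^ 2) =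
      N * ⨍ e : sphere (0 : EuclideanSpace ℝ (Fin N)) 1, dirDensity Ω u x e ∂volume.toSphere := by
  have h1 := integrable_sq_apply_sphere (fderiv ℝ u x)
  have h2 : Integrable (fun e : sphere (0 : EuclideanSpace ℝ (Fin N)) 1 =>
      u x ^ 2 / 4 * dirWeight Ω x e) (volume : Measure _).toSphere := by
    refine ((integrable_sq_mul_dirWeight hΩ hu hc huΩ (φ := fun _ => x) measurable_const
      measurable_subtype_coe (fun z => by simp) (measure_lt_top _ _)).const_mul (1 / 4)).congr
      (ae_of_all _ fun e => ?_)
    ring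
  rw [div_eq_mul_inv, mul_inv, inv_daviesWeight_sq, ← mul_average_sq_apply hN]
  simp only [average_eq, dirDensity, smul_eq_mul]
  rw [integral_sub h1 h2, integral_const_mul]
  ring

lemma energy_eq_average (hN : N = 1 ∨ N = 2) (hΩ : IsOpen Ω) (hu : ContDiff ℝ 1 u)
    (hc : HasCompactSupport u) (huΩ : tsupport u ⊆ Ω) :
    ∫ x in Ω, (‖fderiv ℝ u x‖ ^ 2 - u x ^ 2 / (4 * daviesWeight Ω x ^ 2)) =
      N * ⨍ e : sphere (0 : EuclideanSpace ℝ (Fin N)) 1,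
        (∫ x, dirDensity Ω u x e) ∂volume.toSphere := by
  rw [setIntegral_eq_integral_of_forall_compl_eq_zero]
  · simp only [density_eq_average hN hΩ hu hc huΩ, average_eq, smul_eq_mul]
    rw [integral_const_mul, integral_const_mul,
      integral_integral_swap (integrable_dirDensity_prod hΩ hu hc huΩ)]
  · intro x hx
    have hx' : x ∉ tsupport u := fun h => hx (huΩ h)
    have h0 : fderiv ℝ u x = 0 := by
      by_contra h
      exact hx' (support_fderiv_subset ℝ h)
    rw [h0, image_eq_zero_of_notMem_tsupport hx']
    simp

end energy

/-- The Hardy energy with the Davies weight. -/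
noncomputable def hardyEnergy {N : ℕ} (Ω : Set (EuclideanSpace ℝ (Fin N)))
    (u : EuclideanSpace ℝ (Fin N) → ℝ) : ℝ :=
  ∫ x in Ω, (‖fderiv ℝ u x‖ ^ 2 - u x ^ 2 / (4 * daviesWeight Ω x ^ 2))

lemma integrable_even_pow {N : ℕ} {u : EuclideanSpace ℝ (Fin N) → ℝ} (hu : Continuous u)
    (hc : HasCompactSupport u) {p : ℕ} (hp : 1 ≤ p) : Integrable fun x => u x ^ (2 * p) :=
  (hu.pow _).integrable_of_hasCompactSupport
    (hc.comp_left (g := fun y : ℝ => y ^ (2 * p)) (zero_pow (by omega)))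

lemma even_pow_nonneg (y : ℝ) (p : ℕ) : 0 ≤ y ^ (2 * p) := (even_two_mul p).pow_nonneg y

section line

variable {Ω : Set (EuclideanSpace ℝ (Fin 1))} {u : EuclideanSpace ℝ (Fin 1) → ℝ}

lemma exists_line_chart {e : EuclideanSpace ℝ (Fin 1)} (he : ‖e‖ = 1) :
    ∃ φ : ℝ ≃ᵐ EuclideanSpace ℝ (Fin 1), MeasurePreserving φ ∧ ∀ t, φ t = t • e := by
  let L : ℝ ≃ₗᵢ[ℝ] EuclideanSpace ℝ (Fin 1) :=
    (LinearIsometry.toSpanSingleton ℝ _ he).toLinearIsometryEquiv (by simp)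
  exact ⟨L.toHomeomorph.toMeasurableEquiv, L.measurePreserving, fun t => rfl⟩

lemma energy_line_estimate (hΩ : IsOpen Ω) (hu : ContDiff ℝ 1 u)
    (hc : HasCompactSupport u) (huΩ : tsupport u ⊆ Ω) :
    0 ≤ hardyEnergy Ω u ∧ ∀ x, |u x| ^ 4 ≤ 196 * hardyEnergy Ω u * ∫ x, u x ^ 2 := by
  have hE := energy_eq_average (Or.inl rfl) hΩ hu hc huΩ
  rw [← hardyEnergy, Nat.cast_one, one_mul] at hE
  obtain ⟨e, he⟩ := exists_le_average (Measure.toSphere_ne_zero volume)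
    (integrable_dirDensity_prod hΩ hu hc huΩ).integral_prod_right
  simp only [← hE] at he
  obtain ⟨φ, hφ, hφe⟩ := exists_line_chart (e := e) (by simp)
  obtain ⟨h0, h⟩ := dirDensity_line_estimate 1 le_rfl hΩ hu hc huΩ 0 (e := e) (by simp)
  simp only [zero_add, ← hφe] at h0 h
  have h1 := hφ.integral_comp' fun x => dirDensity Ω u x e
  have h2 := hφ.integral_comp' fun x => u x ^ (2 * 1)
  rw [h1] at h0 h
  rw [h2] at h
  have hE0 := h0.trans he
  refine ⟨hE0, fun x => ?_⟩
  have hx := h (φ.symm x)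
  rw [φ.apply_symm_apply] at hx
  norm_num at hx
  have hU : 0 ≤ ∫ x, u x ^ 2 := integral_nonneg fun _ => sq_nonneg _
  calc |u x| ^ 4 = (u x ^ 2) ^ 2 := by rw [← sq_abs (u x)]; ring
    _ ≤ (14 * (√(∫ x, dirDensity Ω u x e) * √(∫ x, u x ^ 2))) ^ 2 := by gcongr
    _ = 196 * (∫ x, dirDensity Ω u x e) * ∫ x, u x ^ 2 := by
      rw [mul_pow, mul_pow, Real.sq_sqrt h0, Real.sq_sqrt hU]; ring
    _ ≤ _ := by gcongr

end line

section plane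

variable {Ω : Set (EuclideanSpace ℝ (Fin 2))} {u : EuclideanSpace ℝ (Fin 2) → ℝ}

lemma exists_plane_chart {e : EuclideanSpace ℝ (Fin 2)} (he : ‖e‖ = 1) :
    ∃ φ : ℝ × ℝ ≃ᵐ EuclideanSpace ℝ (Fin 2), MeasurePreserving φ ∧
      ∀ z, φ z = z.1 • e + z.2 • planeRot e := by
  obtain ⟨b, hb, hb'⟩ := exists_orthonormalBasis_plane he
  refine ⟨MeasurableEquiv.finTwoArrow.symm.trans ((MeasurableEquiv.toLp 2 (Fin 2 → ℝ)).trans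
    b.repr.symm.toHomeomorph.toMeasurableEquiv), ?_, fun z => ?_⟩
  · exact b.measurePreserving_repr_symm.comp ((PiLp.volume_preserving_toLp (Fin 2)).comp
      (volume_preserving_finTwoArrow ℝ).symm)
  · have := b.sum_repr_symm (WithLp.toLp 2 ![z.1, z.2])
    rw [Fin.sum_univ_two, hb, hb'] at this
    simpa using this.symm

lemma slice_estimate (p : ℕ) (hp : 1 ≤ p) (hΩ : IsOpen Ω) (hu : ContDiff ℝ 1 u)
    (hc : HasCompactSupport u) (huΩ : tsupport u ⊆ Ω) {e : EuclideanSpace ℝ (Fin 2)}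
    (he : ‖e‖ = 1) :
    0 ≤ (∫ x, dirDensity Ω u x e) ∧ 0 ≤ (∫ x, dirDensity Ω u x (planeRot e)) ∧
    ∫ x, u x ^ (2 * (p + 1)) ≤ (2 ^ (p + 1) * (p + 2) + (p + 1)) ^ 2 *
      (√(∫ x, dirDensity Ω u x e) * √(∫ x, dirDensity Ω u x (planeRot e))) *
        ∫ x, u x ^ (2 * p) := by
  obtain ⟨φ, hφ, hφe⟩ := exists_plane_chart he
  have he' : ‖planeRot e‖ = 1 := by rw [LinearIsometryEquiv.norm_map, he]
  set C : ℝ := 2 ^ (p + 1) * (p + 2) + (p + 1) with hC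
  have hC0 : 0 ≤ C := by positivity
  have hfin : (volume : Measure (ℝ × ℝ)) (φ ⁻¹' tsupport u) < ⊤ := by
    rw [hφ.measure_preimage (isClosed_tsupport u).measurableSet.nullMeasurableSet]
    exact hc.isCompact.measure_lt_top
  have hi1 : Integrable (fun z => dirDensity Ω u (φ z) e) (volume.prod volume) :=
    integrable_dirDensity hΩ hu hc huΩ φ.measurable measurable_const (fun _ => he) hfin
  have hi2 : Integrable (fun z => dirDensity Ω u (φ z) (planeRot e)) (volume.prod volume) :=
    integrable_dirDensity hΩ hu hc huΩ φ.measurable measurable_const (fun _ => he') hfin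
  have hi3 : Integrable (fun z => u (φ z) ^ (2 * p)) (volume.prod volume) :=
    hφ.integrable_comp_of_integrable (integrable_even_pow hu.continuous hc hp)
  have hi4 : Integrable (fun z => u (φ z) ^ (2 * (p + 1))) (volume.prod volume) :=
    hφ.integrable_comp_of_integrable (integrable_even_pow hu.continuous hc (by omega))
  have l1 := fun r : ℝ => dirDensity_line_estimate p hp hΩ hu hc huΩ (r • planeRot e) he
  have l2 := fun s : ℝ => dirDensity_line_estimate p hp hΩ hu hc huΩ (s • e) he'
  have e1 : ∀ s r : ℝ, r • planeRot e + s • e = φ (s, r) := fun s r => by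
    rw [hφe, add_comm]
  have e2 : ∀ s r : ℝ, s • e + r • planeRot e = φ (s, r) := fun s r => (hφe (s, r)).symm
  simp only [e1, ← hC] at l1
  simp only [e2, ← hC] at l2
  have t1 : ∫ r : ℝ, ∫ s : ℝ, dirDensity Ω u (φ (s, r)) e = ∫ x, dirDensity Ω u x e := by
    rw [← hφ.integral_comp' fun x => dirDensity Ω u x e]
    exact (integral_prod_symm _ hi1).symm
  have t2 : ∫ s : ℝ, ∫ r : ℝ, dirDensity Ω u (φ (s, r)) (planeRot e) =
      ∫ x, dirDensity Ω u x (planeRot e) := by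
    rw [← hφ.integral_comp' fun x => dirDensity Ω u x (planeRot e)]
    exact (integral_prod _ hi2).symm
  have t3 : ∫ r : ℝ, ∫ s : ℝ, u (φ (s, r)) ^ (2 * p) = ∫ x, u x ^ (2 * p) := by
    rw [← hφ.integral_comp' fun x => u x ^ (2 * p)]
    exact (integral_prod_symm _ hi3).symm
  have t4 : ∫ s : ℝ, ∫ r : ℝ, u (φ (s, r)) ^ (2 * p) = ∫ x, u x ^ (2 * p) := by
    rw [← hφ.integral_comp' fun x => u x ^ (2 * p)]
    exact (integral_prod _ hi3).symm
  have n1 : ∀ r : ℝ, 0 ≤ ∫ s : ℝ, dirDensity Ω u (φ (s, r)) e := fun r => (l1 r).1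
  have n2 : ∀ s : ℝ, 0 ≤ ∫ r : ℝ, dirDensity Ω u (φ (s, r)) (planeRot e) := fun s => (l2 s).1
  have n3 : ∀ r : ℝ, 0 ≤ ∫ s : ℝ, u (φ (s, r)) ^ (2 * p) := fun r =>
    integral_nonneg fun s => even_pow_nonneg _ _
  have n4 : ∀ s : ℝ, 0 ≤ ∫ r : ℝ, u (φ (s, r)) ^ (2 * p) := fun s =>
    integral_nonneg fun r => even_pow_nonneg _ _
  refine ⟨t1 ▸ integral_nonneg n1, t2 ▸ integral_nonneg n2, ?_⟩
  have c1 := integral_sqrt_mul_sqrt_le n1 n3 hi1.integral_prod_right hi3.integral_prod_right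
  have c2 := integral_sqrt_mul_sqrt_le n2 n4 hi2.integral_prod_left hi3.integral_prod_left
  have i1 := integrable_sqrt_mul_sqrt n1 n3 hi1.integral_prod_right hi3.integral_prod_right
  have i2 := integrable_sqrt_mul_sqrt n2 n4 hi2.integral_prod_left hi3.integral_prod_left
  rw [t1, t3] at c1
  rw [t2, t4] at c2
  have hP : 0 ≤ ∫ x, u x ^ (2 * p) := integral_nonneg fun _ => even_pow_nonneg _ _
  set F : ℝ → ℝ := fun r => √(∫ s : ℝ, dirDensity Ω u (φ (s, r)) e) *
    √(∫ s : ℝ, u (φ (s, r)) ^ (2 * p)) with hF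
  set G : ℝ → ℝ := fun s => √(∫ r : ℝ, dirDensity Ω u (φ (s, r)) (planeRot e)) *
    √(∫ r : ℝ, u (φ (s, r)) ^ (2 * p)) with hG
  have hFn : ∀ r, 0 ≤ F r := fun r => by positivity
  have hGn : ∀ r, 0 ≤ G r := fun r => by positivity
  calc ∫ x, u x ^ (2 * (p + 1)) = ∫ z, u (φ z) ^ (2 * (p + 1)) :=
        (hφ.integral_comp' fun x => u x ^ (2 * (p + 1))).symm
    _ ≤ ∫ z : ℝ × ℝ, C ^ 2 * (G z.1 * F z.2) := by
        refine integral_mono hi4 ((i2.mul_prod i1).const_mul _) fun z => ?_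
        have a1 : |u (φ z)| ^ (p + 1) ≤ C * F z.2 := (l1 z.2).2 z.1
        have a2 : |u (φ z)| ^ (p + 1) ≤ C * G z.1 := (l2 z.1).2 z.2
        calc u (φ z) ^ (2 * (p + 1)) = |u (φ z)| ^ (p + 1) * |u (φ z)| ^ (p + 1) := by
              rw [pow_mul, ← sq_abs, ← pow_mul, ← pow_add]; congr 1; ring
          _ ≤ (C * F z.2) * (C * G z.1) := by
              have := hFn z.2
              gcongr
          _ = C ^ 2 * (G z.1 * F z.2) := by ring
    _ = C ^ 2 * ((∫ s, G s) * ∫ r, F r) := by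
        rw [integral_const_mul]
        congr 1
        exact integral_prod_mul G F
    _ ≤ C ^ 2 * ((√(∫ x, dirDensity Ω u x (planeRot e)) * √(∫ x, u x ^ (2 * p))) *
          (√(∫ x, dirDensity Ω u x e) * √(∫ x, u x ^ (2 * p)))) := by
        have : 0 ≤ ∫ r, F r := integral_nonneg hFn
        gcongr
    _ = C ^ 2 * (√(∫ x, dirDensity Ω u x e) * √(∫ x, dirDensity Ω u x (planeRot e))) *
        (√(∫ x, u x ^ (2 * p)) * √(∫ x, u x ^ (2 * p))) := by ring
    _ = _ := by rw [Real.mul_self_sqrt hP]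

lemma energy_plane_estimate (p : ℕ) (hp : 1 ≤ p) (hΩ : IsOpen Ω) (hu : ContDiff ℝ 1 u)
    (hc : HasCompactSupport u) (huΩ : tsupport u ⊆ Ω) :
    0 ≤ hardyEnergy Ω u ∧
    ∫ x, u x ^ (2 * (p + 1)) ≤ (2 ^ (p + 1) * (p + 2) + (p + 1)) ^ 2 * hardyEnergy Ω u *
        ∫ x, u x ^ (2 * p) := by
  have hE := energy_eq_average (Or.inr rfl) hΩ hu hc huΩ
  rw [← hardyEnergy] at hE
  have hi := (integrable_dirDensity_prod hΩ hu hc huΩ).integral_prod_right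
  have hi2 : Integrable (fun e => ∫ x, dirDensity Ω u x (sphereMap planeRot e)) _ :=
    (measurePreserving_sphereMap planeRot).integrable_comp_of_integrable hi
  obtain ⟨e, he⟩ := exists_le_average (Measure.toSphere_ne_zero volume) (hi.add hi2)
  have h2 := average_sphereMap planeRot hi
  have key : (∫ x, dirDensity Ω u x e) + (∫ x, dirDensity Ω u x (planeRot e)) ≤
      hardyEnergy Ω u := by
    refine he.trans (le_of_eq ?_)
    rw [hE, average_eq]
    simp only [Pi.add_apply]
    rw [integral_add hi hi2, smul_add, ← average_eq, ← average_eq]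
    simp only at h2
    rw [h2]
    push_cast
    ring
  obtain ⟨h0, h1, h⟩ := slice_estimate p hp hΩ hu hc huΩ (e := e) (by simp)
  have hP : 0 ≤ ∫ x, u x ^ (2 * p) := integral_nonneg fun _ => even_pow_nonneg _ _
  refine ⟨by linarith, h.trans ?_⟩
  gcongr
  calc _ ≤ √(hardyEnergy Ω u) * √(hardyEnergy Ω u) := by
        gcongr <;> linarith
    _ = _ := Real.mul_self_sqrt (by linarith)

lemma exists_even_pow_estimate (k : ℕ) :
    ∃ C : ℝ, 0 < C ∧ ∀ (Ω : Set (EuclideanSpace ℝ (Fin 2))) (u : EuclideanSpace ℝ (Fin 2) → ℝ),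
      IsOpen Ω → ContDiff ℝ 1 u → HasCompactSupport u → tsupport u ⊆ Ω →
      ∫ x, u x ^ (2 * (k + 1)) ≤ C * hardyEnergy Ω u ^ k * ∫ x, u x ^ 2 := by
  induction k with
  | zero => exact ⟨1, one_pos, fun Ω u _ _ _ _ => by simp⟩
  | succ k ih =>
    obtain ⟨C, hC, h⟩ := ih
    refine ⟨(2 ^ (k + 1 + 1) * ((k + 1 : ℕ) + 2) + ((k + 1 : ℕ) + 1)) ^ 2 * C, by positivity,
      fun Ω u hΩ hu hc huΩ => ?_⟩
    obtain ⟨h0, h1⟩ := energy_plane_estimate (k + 1) (by omega) hΩ hu hc huΩ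
    refine h1.trans ?_
    calc _ ≤ (2 ^ (k + 1 + 1) * ((k + 1 : ℕ) + 2) + ((k + 1 : ℕ) + 1)) ^ 2 * hardyEnergy Ω u *
          (C * hardyEnergy Ω u ^ k * ∫ x, u x ^ 2) := by
          gcongr
          exact h Ω u hΩ hu hc huΩ
      _ = _ := by ring

end plane

lemma abs_rpow_eq_sq_rpow_mul {q : ℝ} (hq : 2 ≤ q) (y : ℝ) :
    |y| ^ q = (y ^ 2) ^ ((q - 2) / 2) * y ^ 2 := by
  rw [← sq_abs, ← Real.rpow_natCast, ← Real.rpow_mul (abs_nonneg y),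
    ← Real.rpow_add_of_nonneg (abs_nonneg y) (by push_cast; linarith) (by positivity)]
  congr 1
  push_cast
  ring

lemma rpow_le_rpow_add_mul_pow {s y T : ℝ} {k : ℕ} (hs : 0 ≤ s) (hsk : s ≤ k) (hy : 0 ≤ y)
    (hT : 0 < T) : y ^ s ≤ T ^ s + T ^ (s - k) * y ^ k := by
  rcases le_total y T with h | h
  · have := Real.rpow_le_rpow hy h hs
    have : 0 ≤ T ^ (s - k) * y ^ k := by positivity
    linarith
  · have hy' : 0 < y := hT.trans_le h
    have h1 : y ^ s = y ^ (s - k) * y ^ k := by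
      rw [← Real.rpow_natCast, ← Real.rpow_add hy', sub_add_cancel]
    have h2 : y ^ (s - k) ≤ T ^ (s - k) := Real.rpow_le_rpow_of_nonpos hT h (by linarith)
    have h3 : y ^ s ≤ T ^ (s - k) * y ^ k := by rw [h1]; gcongr
    have : 0 ≤ T ^ s := by positivity
    linarith

lemma exists_rpow_estimate_line {q : ℝ} (hq : 2 ≤ q) :
    ∃ C : ℝ, 0 < C ∧ ∀ (Ω : Set (EuclideanSpace ℝ (Fin 1))) (u : EuclideanSpace ℝ (Fin 1) → ℝ),
      IsOpen Ω → ContDiff ℝ 1 u → HasCompactSupport u → tsupport u ⊆ Ω →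
      0 ≤ hardyEnergy Ω u ∧ ∫ x, |u x| ^ q ≤
        C * hardyEnergy Ω u ^ ((q - 2) / 4) * (∫ x, u x ^ 2) ^ ((q - 2) / 4 + 1) := by
  refine ⟨196 ^ ((q - 2) / 4), by positivity, fun Ω u hΩ hu hc huΩ => ?_⟩
  obtain ⟨h0, h⟩ := energy_line_estimate hΩ hu hc huΩ
  refine ⟨h0, ?_⟩
  have hU : 0 ≤ ∫ x, u x ^ 2 := integral_nonneg fun _ => sq_nonneg _
  have hs : 0 ≤ (q - 2) / 4 := by linarith
  calc ∫ x, |u x| ^ q ≤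
        ∫ x, (196 * hardyEnergy Ω u * ∫ x, u x ^ 2) ^ ((q - 2) / 4) * u x ^ 2 := by
        refine integral_mono_of_nonneg (ae_of_all _ fun x => by positivity)
          ((integrable_even_pow hu.continuous hc le_rfl).const_mul _) (ae_of_all _ fun x => ?_)
        simp only
        rw [abs_rpow_eq_sq_rpow_mul hq]
        have h1 : (u x ^ 2) ^ ((q - 2) / 2) = (|u x| ^ 4) ^ ((q - 2) / 4) := by
          rw [← sq_abs, ← Real.rpow_natCast, ← Real.rpow_natCast, ← Real.rpow_mul (abs_nonneg _),
            ← Real.rpow_mul (abs_nonneg _)]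
          congr 1
          push_cast
          ring
        rw [h1]
        gcongr
        exact h x
    _ = _ := by
        rw [integral_const_mul, Real.mul_rpow (by positivity) hU,
          Real.mul_rpow (by positivity) h0, Real.rpow_add_of_nonneg hU hs zero_le_one,
          Real.rpow_one]
        ring

lemma exists_rpow_estimate_plane {q : ℝ} (hq : 2 ≤ q) :
    ∃ C : ℝ, 0 < C ∧ ∀ (Ω : Set (EuclideanSpace ℝ (Fin 2))) (u : EuclideanSpace ℝ (Fin 2) → ℝ),
      IsOpen Ω → ContDiff ℝ 1 u → HasCompactSupport u → tsupport u ⊆ Ω →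
      0 ≤ hardyEnergy Ω u ∧ ∫ x, |u x| ^ q ≤
        C * hardyEnergy Ω u ^ ((q - 2) / 2) * ∫ x, u x ^ 2 := by
  obtain ⟨k, hk⟩ := exists_nat_gt ((q - 2) / 2)
  have hs : 0 ≤ (q - 2) / 2 := by linarith
  have hk0 : k ≠ 0 := by
    rintro rfl
    norm_num at hk
    linarith
  obtain ⟨C, hC, hest⟩ := exists_even_pow_estimate k
  refine ⟨1 + C, by positivity, fun Ω u hΩ hu hc huΩ => ?_⟩
  have h0 := (energy_plane_estimate 1 le_rfl hΩ hu hc huΩ).1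
  refine ⟨h0, ?_⟩
  have hU : 0 ≤ ∫ x, u x ^ 2 := integral_nonneg fun _ => sq_nonneg _
  have h := hest Ω u hΩ hu hc huΩ
  have i1 : Integrable fun x => u x ^ 2 := integrable_even_pow hu.continuous hc le_rfl
  have i2 : Integrable fun x => u x ^ (2 * (k + 1)) :=
    integrable_even_pow hu.continuous hc (by omega)
  rcases h0.eq_or_lt with hE | hE
  · rw [← hE, zero_pow hk0, mul_zero, zero_mul] at h
    have hz := (integral_eq_zero_iff_of_nonneg (fun x => even_pow_nonneg (u x) (k + 1)) i2).1
      (h.antisymm (integral_nonneg fun x => even_pow_nonneg (u x) (k + 1)))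
    have : ∫ x, |u x| ^ q = 0 := by
      refine integral_eq_zero_of_ae ?_
      filter_upwards [hz] with x hx
      have : u x = 0 := pow_eq_zero_iff (by omega) |>.1 hx
      simp [this, Real.zero_rpow (by linarith : q ≠ 0)]
    rw [this]
    positivity
  · calc ∫ x, |u x| ^ q ≤ ∫ x, (hardyEnergy Ω u ^ ((q - 2) / 2) * u x ^ 2 +
          hardyEnergy Ω u ^ ((q - 2) / 2 - k) * u x ^ (2 * (k + 1))) := by
          refine integral_mono_of_nonneg (ae_of_all _ fun x => by positivity)
            ((i1.const_mul _).add (i2.const_mul _)) (ae_of_all _ fun x => ?_)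
          simp only
          rw [abs_rpow_eq_sq_rpow_mul hq]
          calc _ ≤ (hardyEnergy Ω u ^ ((q - 2) / 2) +
                hardyEnergy Ω u ^ ((q - 2) / 2 - k) * (u x ^ 2) ^ k) * u x ^ 2 := by
                gcongr
                exact rpow_le_rpow_add_mul_pow hs hk.le (sq_nonneg _) hE
            _ = _ := by ring
      _ = hardyEnergy Ω u ^ ((q - 2) / 2) * (∫ x, u x ^ 2) +
          hardyEnergy Ω u ^ ((q - 2) / 2 - k) * ∫ x, u x ^ (2 * (k + 1)) := by
          rw [integral_add (i1.const_mul _) (i2.const_mul _), integral_const_mul,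
            integral_const_mul]
      _ ≤ hardyEnergy Ω u ^ ((q - 2) / 2) * (∫ x, u x ^ 2) +
          hardyEnergy Ω u ^ ((q - 2) / 2 - k) * (C * hardyEnergy Ω u ^ k * ∫ x, u x ^ 2) := by
          gcongr
      _ = _ := by
          rw [Real.rpow_sub hE, Real.rpow_natCast]
          field_simp

lemma inv_rpow_mul_rpow_le {q C E U A a b : ℝ} (hq : 2 ≤ q) (hC : 0 < C) (hE : 0 ≤ E)
    (hU : 0 ≤ U) (hA : 0 ≤ A) (h : A ≤ C * E ^ a * U ^ b) :
    (C ^ (2 / q))⁻¹ * A ^ (2 / q) ≤ E ^ (a * (2 / q)) * U ^ (b * (2 / q)) := by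
  rw [inv_mul_le_iff₀ (by positivity)]
  refine (Real.rpow_le_rpow hA h (by positivity)).trans (le_of_eq ?_)
  rw [Real.mul_rpow (by positivity) (by positivity), Real.mul_rpow hC.le (by positivity),
    ← Real.rpow_mul hE, ← Real.rpow_mul hU]
  ring

/-- **Hardy–Sobolev–Maz'ya interpolation inequality in dimensions 1 and 2** (Theorem 2):
for `N ∈ {1,2}` and `2 ≤ q < ∞`, with `θ = (N/2)(1 − 2/q)`, there is a constant `K > 0` such
that for every domain `Ω ⊊ ℝ^N` and every `u ∈ C_0^∞(Ω)`,
`(∫_Ω (|∇u|² − |u|²/(4 D_Ω²)))^θ (∫_Ω |u|²)^{1−θ} ≥ K (∫_Ω |u|^q)^{2/q}`. -/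
theorem hardy_sobolev_mazya_dim_one_two (N : ℕ) (hN : N = 1 ∨ N = 2) (q : ℝ) (hq : 2 ≤ q) :
    ∃ K : ℝ, 0 < K ∧
      ∀ (Ω : Set (EuclideanSpace ℝ (Fin N))), IsOpen Ω → IsConnected Ω → Ω ≠ Set.univ →
        ∀ u : EuclideanSpace ℝ (Fin N) → ℝ,
          ContDiff ℝ (⊤ : ℕ∞) u → HasCompactSupport u → tsupport u ⊆ Ω →
          K * (∫ x in Ω, |u x| ^ q) ^ (2 / q) ≤
            (∫ x in Ω, (‖fderiv ℝ u x‖ ^ 2 - u x ^ 2 / (4 * daviesWeight Ω x ^ 2)))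
                ^ ((N : ℝ) / 2 * (1 - 2 / q)) *
              (∫ x in Ω, u x ^ 2) ^ (1 - (N : ℝ) / 2 * (1 - 2 / q)) := by
  have hq0 : q ≠ 0 := by linarith
  obtain ⟨C, hC, h⟩ : ∃ C : ℝ, 0 < C ∧
      ∀ (Ω : Set (EuclideanSpace ℝ (Fin N))) (u : EuclideanSpace ℝ (Fin N) → ℝ),
      IsOpen Ω → ContDiff ℝ 1 u → HasCompactSupport u → tsupport u ⊆ Ω →
      0 ≤ hardyEnergy Ω u ∧ ∫ x, |u x| ^ q ≤ C * hardyEnergy Ω u ^ ((N : ℝ) * (q - 2) / 4) *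
        (∫ x, u x ^ 2) ^ (q / 2 - (N : ℝ) * (q - 2) / 4) := by
    rcases hN with rfl | rfl
    · have e1 : ((1 : ℕ) : ℝ) * (q - 2) / 4 = (q - 2) / 4 := by push_cast; ring
      have e2 : q / 2 - (q - 2) / 4 = (q - 2) / 4 + 1 := by ring
      rw [e1, e2]
      exact exists_rpow_estimate_line hq
    · have e1 : ((2 : ℕ) : ℝ) * (q - 2) / 4 = (q - 2) / 2 := by push_cast; ring
      have e2 : q / 2 - (q - 2) / 2 = 1 := by ring
      simp only [e1, e2, Real.rpow_one]
      exact exists_rpow_estimate_plane hq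
  refine ⟨(C ^ (2 / q))⁻¹, by positivity, fun Ω hΩ _ _ u hu hc huΩ => ?_⟩
  have hu0 : ∀ x ∉ Ω, u x = 0 := fun x hx =>
    image_eq_zero_of_notMem_tsupport fun h => hx (huΩ h)
  obtain ⟨h0, h1⟩ := h Ω u hΩ (hu.of_le (by exact_mod_cast le_top)) hc huΩ
  rw [setIntegral_eq_integral_of_forall_compl_eq_zero (f := fun x => |u x| ^ q)
      fun x hx => by simp [hu0 x hx, Real.zero_rpow hq0],
    setIntegral_eq_integral_of_forall_compl_eq_zero (f := fun x => u x ^ 2)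
      fun x hx => by simp [hu0 x hx]]
  have hU : 0 ≤ ∫ x, u x ^ 2 := integral_nonneg fun _ => sq_nonneg _
  have hA : 0 ≤ ∫ x, |u x| ^ q := integral_nonneg fun _ => by positivity
  have e1 : (N : ℝ) / 2 * (1 - 2 / q) = (N : ℝ) * (q - 2) / 4 * (2 / q) := by
    field_simp
    ring
  have e2 : 1 - (N : ℝ) * (q - 2) / 4 * (2 / q) = (q / 2 - (N : ℝ) * (q - 2) / 4) * (2 / q) := by
    field_simp
  rw [e1, e2]
  exact inv_rpow_mul_rpow_le hq hC h0 hU hA h1
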